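/- Let 𝕜 be ℝ or ℂ. Then the sequence n ↦ g[RP_n(𝕜)] is non-decreasing: g[RP_n(𝕜)] ≤ g[RP_{n+1}(𝕜)] for every n ≥ 1. -/

import Mathlib

open scoped BigOperators

/-- `geIter A k` is the Gaussian elimination iterate `A^{(k+1)}` (0-indexed, `geIter A 0 = A`).
Entries with row or column index `< k` are left unchanged; they are irrelevant. -/
noncomputable def geIter {𝕜 : Type*} [Field 𝕜] {n : ℕ} (A : Matrix (Fin n) (Fin n) 𝕜) :
    ℕ → Matrix (Fin n) (Fin n) 𝕜
  | 0 => A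
  | k + 1 => fun i j =>
    if h : k < n ∧ k + 1 ≤ i.1 ∧ k + 1 ≤ j.1 then
      geIter A k i j -
        geIter A k i ⟨k, h.1⟩ * geIter A k ⟨k, h.1⟩ j / geIter A k ⟨k, h.1⟩ ⟨k, h.1⟩
    else geIter A k i j

/-- The norm of the pivot `a^{(k+1)}_{k,k}` (0-indexed). -/
noncomputable def pivotNorm {𝕜 : Type*} [RCLike 𝕜] {n : ℕ}
    (A : Matrix (Fin n) (Fin n) 𝕜) (k : ℕ) : ℝ :=
  if h : k < n then ‖geIter A k ⟨k, h⟩ ⟨k, h⟩‖ else 0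

/-- The growth factor `g(A)`. -/
noncomputable def growth {𝕜 : Type*} [RCLike 𝕜] {n : ℕ} (A : Matrix (Fin n) (Fin n) 𝕜) : ℝ :=
  (⨆ k : Fin n, ⨆ i : Fin n, ⨆ j : Fin n,
      if k.1 ≤ i.1 ∧ k.1 ≤ j.1 then ‖geIter A k.1 i j‖ else 0) /
    ⨆ i : Fin n, ⨆ j : Fin n, ‖A i j‖

/-- `A` is rook pivoted: `A ∈ RP_n(𝕜)`. -/
def IsRP {𝕜 : Type*} [RCLike 𝕜] {n : ℕ} (A : Matrix (Fin n) (Fin n) 𝕜) : Prop :=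
  A.det ≠ 0 ∧ (∀ k : ℕ, k + 1 < n → pivotNorm A k ≠ 0) ∧
    ∀ (k : ℕ) (hk : k < n) (i : Fin n), k ≤ i.1 →
      ‖geIter A k i ⟨k, hk⟩‖ ≤ pivotNorm A k ∧ ‖geIter A k ⟨k, hk⟩ i‖ ≤ pivotNorm A k

/-- `g[RP_n(𝕜)]`. -/
noncomputable def gRP (𝕜 : Type*) [RCLike 𝕜] (n : ℕ) : ℝ :=
  sSup (growth '' {A : Matrix (Fin n) (Fin n) 𝕜 | IsRP A})

theorem le_iSup3 {n : ℕ} (f : Fin n → Fin n → Fin n → ℝ) (k i j : Fin n) :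
    f k i j ≤ ⨆ k, ⨆ i, ⨆ j, f k i j :=
  ((le_ciSup (Set.finite_range (fun j => f k i j)).bddAbove j).trans
    (le_ciSup (Set.finite_range (fun i => ⨆ j, f k i j)).bddAbove i)).trans
    (le_ciSup (Set.finite_range (fun k => ⨆ i, ⨆ j, f k i j)).bddAbove k)

theorem le_iSup2 {n : ℕ} (f : Fin n → Fin n → ℝ) (i j : Fin n) :
    f i j ≤ ⨆ i, ⨆ j, f i j :=
  (le_ciSup (Set.finite_range (fun j => f i j)).bddAbove j).trans
    (le_ciSup (Set.finite_range (fun i => ⨆ j, f i j)).bddAbove i)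

section
variable {𝕜 : Type*} [RCLike 𝕜] {n : ℕ}

theorem maxA_nonneg (A : Matrix (Fin n) (Fin n) 𝕜) : 0 ≤ ⨆ i : Fin n, ⨆ j : Fin n, ‖A i j‖ :=
  Real.iSup_nonneg fun _ => Real.iSup_nonneg fun _ => norm_nonneg _

theorem num_nonneg (A : Matrix (Fin n) (Fin n) 𝕜) :
    0 ≤ ⨆ k : Fin n, ⨆ i : Fin n, ⨆ j : Fin n,
      if k.1 ≤ i.1 ∧ k.1 ≤ j.1 then ‖geIter A k.1 i j‖ else 0 :=
  Real.iSup_nonneg fun _ => Real.iSup_nonneg fun _ => Real.iSup_nonneg fun _ => by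
    split_ifs <;> positivity

theorem growth_nonneg (A : Matrix (Fin n) (Fin n) 𝕜) : 0 ≤ growth A :=
  div_nonneg (num_nonneg A) (maxA_nonneg A)

theorem geIter_pos (A : Matrix (Fin n) (Fin n) 𝕜) (k : ℕ) (i j : Fin n)
    (h : k < n ∧ k + 1 ≤ i.1 ∧ k + 1 ≤ j.1) :
    geIter A (k + 1) i j = geIter A k i j -
        geIter A k i ⟨k, h.1⟩ * geIter A k ⟨k, h.1⟩ j / geIter A k ⟨k, h.1⟩ ⟨k, h.1⟩ :=
  dif_pos h

theorem geIter_neg (A : Matrix (Fin n) (Fin n) 𝕜) (k : ℕ) (i j : Fin n)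
    (h : ¬ (k < n ∧ k + 1 ≤ i.1 ∧ k + 1 ≤ j.1)) :
    geIter A (k + 1) i j = geIter A k i j :=
  dif_neg h

theorem geIter_bound (A : Matrix (Fin n) (Fin n) 𝕜) (hA : IsRP A) (k : ℕ) :
    ∀ i j, ‖geIter A k i j‖ ≤ 2 ^ k * ⨆ i : Fin n, ⨆ j : Fin n, ‖A i j‖ := by
  have hM := maxA_nonneg A
  induction k with
  | zero => intro i j; simpa [geIter] using le_iSup2 (fun i j => ‖A i j‖) i j
  | succ k ih =>
    intro i j
    set M := ⨆ i : Fin n, ⨆ j : Fin n, ‖A i j‖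
    have h2 : (0 : ℝ) ≤ 2 ^ k * M := by positivity
    have h3 : (2 : ℝ) ^ (k + 1) * M = 2 ^ k * M + 2 ^ k * M := by ring
    by_cases h : k < n ∧ k + 1 ≤ i.1 ∧ k + 1 ≤ j.1
    · rw [geIter_pos _ _ _ _ h]
      have h1 := (hA.2.2 k h.1 j (by omega)).2
      rw [pivotNorm, dif_pos h.1] at h1
      refine (norm_sub_le _ _).trans ?_
      rw [h3]
      refine add_le_add (ih i j) ?_
      rw [norm_div, norm_mul, mul_div_assoc]
      refine (mul_le_of_le_one_right (norm_nonneg _) ?_).trans (ih i ⟨k, h.1⟩)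
      exact div_le_one_of_le₀ h1 (norm_nonneg _)
    · rw [geIter_neg _ _ _ _ h]
      linarith [ih i j]

theorem growth_bound (A : Matrix (Fin n) (Fin n) 𝕜) (hA : IsRP A) : growth A ≤ 2 ^ n := by
  have hM := maxA_nonneg A
  refine div_le_of_le_mul₀ hM (by positivity) ?_
  have h0 : 0 ≤ 2 ^ n * ⨆ i : Fin n, ⨆ j : Fin n, ‖A i j‖ := by positivity
  refine Real.iSup_le (fun k => Real.iSup_le (fun i => Real.iSup_le (fun j => ?_) h0) h0) h0
  split_ifs
  · refine (geIter_bound A hA k i j).trans ?_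
    have : k.1 ≤ n := k.2.le
    gcongr
    norm_num
  · exact h0

/-- The block diagonal matrix with blocks `c` and `A`. -/
def extMat (c : 𝕜) (A : Matrix (Fin n) (Fin n) 𝕜) : Matrix (Fin (n + 1)) (Fin (n + 1)) 𝕜 :=
  fun i j => Fin.cases (Fin.cases c (fun _ => 0) j) (fun i' => Fin.cases 0 (fun j' => A i' j') j) i

variable (c : 𝕜) (A : Matrix (Fin n) (Fin n) 𝕜)

@[simp] theorem ext00 : extMat c A 0 0 = c := rfl
@[simp] theorem ext0s (j : Fin n) : extMat c A 0 j.succ = 0 := rfl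
@[simp] theorem exts0 (i : Fin n) : extMat c A i.succ 0 = 0 := rfl
@[simp] theorem extss (i j : Fin n) : extMat c A i.succ j.succ = A i j := rfl

theorem ext_det : (extMat c A).det = c * A.det := by
  rw [Matrix.det_succ_row_zero, Fin.sum_univ_succ]
  have : (extMat c A).submatrix Fin.succ Fin.succ = A := rfl
  simp [this]

theorem ext_geIter (k : ℕ) : ∀ i j : Fin n,
    geIter (extMat c A) (k + 1) i.succ j.succ = geIter A k i j := by
  induction k with
  | zero =>
    intro i j
    simp [geIter]
  | succ k ih =>
    intro i j
    by_cases h : k < n ∧ k + 1 ≤ i.1 ∧ k + 1 ≤ j.1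
    · rw [geIter_pos _ _ _ _ (by simpa using h), geIter_pos _ _ _ _ h, ← ih, ← ih, ← ih, ← ih]
      rfl
    · rw [geIter_neg _ _ _ _ (by simpa using h), geIter_neg _ _ _ _ h, ih]

theorem ext_pivot (k : ℕ) : pivotNorm (extMat c A) (k + 1) = pivotNorm A k := by
  unfold pivotNorm
  by_cases h : k < n
  · rw [dif_pos h, dif_pos (by omega), ← ext_geIter c A]
    rfl
  · rw [dif_neg h, dif_neg (by omega)]

theorem ext_pivot0 : pivotNorm (extMat c A) 0 = ‖c‖ := by
  simp [pivotNorm, geIter]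

theorem ext_RP (hc : c ≠ 0) (hA : IsRP A) : IsRP (extMat c A) := by
  refine ⟨by rw [ext_det]; exact mul_ne_zero hc hA.1, ?_, ?_⟩
  · rintro (_ | k) hk
    · rw [ext_pivot0]; simpa using hc
    · rw [ext_pivot]; exact hA.2.1 k (by omega)
  · rintro (_ | k) hk i hi
    · rw [ext_pivot0]
      refine Fin.cases ?_ (fun i => ?_) i <;> simp [geIter]
    · rw [ext_pivot]
      obtain ⟨i, rfl⟩ := Fin.exists_succ_eq.2 (show i ≠ 0 by rintro rfl; simp at hi)
      have hk' : k < n := by omega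
      have := hA.2.2 k hk' i (by simpa using hi)
      rw [← ext_geIter c A, ← ext_geIter c A] at this
      exact this

theorem ext_growth (hc : c ≠ 0) (hcA : ∃ i j, A i j = c) : growth A ≤ growth (extMat c A) := by
  unfold growth
  refine div_le_div₀ (num_nonneg _) ?_ ?_ ?_
  · have h0 := num_nonneg (extMat c A)
    refine Real.iSup_le (fun k => Real.iSup_le (fun i => Real.iSup_le (fun j => ?_) h0) h0) h0
    refine le_trans (le_of_eq ?_) (le_iSup3 (fun k i j : Fin (n + 1) =>
      if k.1 ≤ i.1 ∧ k.1 ≤ j.1 then ‖geIter (extMat c A) k.1 i j‖ else 0) k.succ i.succ j.succ)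
    simp [ext_geIter]
  · refine lt_of_lt_of_le (norm_pos_iff.2 hc) ?_
    exact le_iSup2 (fun i j => ‖extMat c A i j‖) 0 0
  · have h0 := maxA_nonneg A
    refine Real.iSup_le (fun i => Real.iSup_le (fun j => ?_) h0) h0
    refine Fin.cases ?_ (fun i => ?_) i <;> refine Fin.cases ?_ (fun j => ?_) j
    · obtain ⟨i, j, h⟩ := hcA
      rw [ext00, ← h]
      exact le_iSup2 (fun i j => ‖A i j‖) i j
    · simpa using h0
    · simpa using h0
    · exact le_iSup2 (fun i j => ‖A i j‖) i j

end

/-- `n ↦ g[RP_n(𝕜)]` is non-decreasing. -/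
theorem gRP_monotone {𝕜 : Type*} [RCLike 𝕜] (n : ℕ) (hn : 1 ≤ n) :
    gRP 𝕜 n ≤ gRP 𝕜 (n + 1) := by
  unfold gRP
  refine Real.sSup_le ?_ (Real.sSup_nonneg ?_)
  · rintro _ ⟨A, hA, rfl⟩
    have hex : ∃ i j, A i j ≠ 0 := by
      by_contra! h
      have : A = 0 := by ext i j; exact h i j
      apply hA.1
      have : Nonempty (Fin n) := ⟨⟨0, hn⟩⟩
      subst A
      exact Matrix.det_zero
    obtain ⟨i, j, hij⟩ := hex
    refine (ext_growth (A i j) A hij ⟨i, j, rfl⟩).trans (le_csSup ?_ ?_)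
    · refine ⟨2 ^ (n + 1), ?_⟩
      rintro _ ⟨B, hB, rfl⟩
      exact growth_bound B hB
    · exact ⟨_, ext_RP _ A hij hA, rfl⟩
  · rintro _ ⟨A, _, rfl⟩
    exact growth_nonneg A
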